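/- arXiv:2602.04042 — 5 statements merged into one kernel-verified Lean document; each statement's English description precedes it below -/
import Mathlib

section
/- Let A be a measurable cell with 0 < ν(A) < ∞, split into disjoint measurable cells A_l, A_r with A = A_l ∪ A_r and ν(A_l), ν(A_r) > 0. Let ν_A(B) := ν(B ∩ A)/ν(A) be the normalized restriction of ν to A, let 𝒢 := σ({A_l, A_r}) be the σ-algebra generated by the split, and let X(z) := E_{ν_A}[f | 𝒢](z) be the conditional expectation of f with respect to 𝒢 under ν_A. Then the population log-loss gain of the split equals the Jensen gap times ν(A): G = ν(A) · ( E_{ν_A}[φ(X)] − φ(E_{ν_A}[X]) ), where φ(u) := u log u. -/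
open MeasureTheory

/-- `φ(u) = u log u`, with the convention `0 log 0 = 0` (automatic since `Real.log 0 = 0`). -/
noncomputable def phi (u : ℝ) : ℝ := u * Real.log u

theorem atom_aux {Z : Type*} (C : Set (Set Z)) (S : Set Z)
    (hC : ∀ t ∈ C, S ⊆ t ∨ Disjoint S t) (t : Set Z)
    (ht : MeasurableSet[MeasurableSpace.generateFrom C] t) : S ⊆ t ∨ Disjoint S t := by
  induction t, ht using MeasurableSpace.generateFrom_induction with
  | hC t ht _ => exact hC t ht
  | empty => right; simp
  | compl t _ ih =>
    rcases ih with h | h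
    · right; exact Set.disjoint_compl_right_iff_subset.2 h
    · left; exact Set.subset_compl_iff_disjoint_right.2 h
  | iUnion s _ ih =>
    by_cases h : ∃ n, S ⊆ s n
    · obtain ⟨n, hn⟩ := h
      left; exact hn.trans (Set.subset_iUnion s n)
    · right
      push Not at h
      exact Set.disjoint_iUnion_right.2 fun n => (ih n).resolve_left (h n)

theorem const_aux {Z : Type*} (C : Set (Set Z)) (S : Set Z)
    (hC : ∀ t ∈ C, S ⊆ t ∨ Disjoint S t) (g : Z → ℝ)
    (hg : Measurable[MeasurableSpace.generateFrom C] g) (x y : Z) (hx : x ∈ S) (hy : y ∈ S) :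
    g y = g x := by
  rcases atom_aux C S hC (g ⁻¹' {g x}) (hg (measurableSet_singleton _)) with h | h
  · exact h hy
  · exact absurd rfl (Set.disjoint_left.1 h hx)

/-- The population log-loss gain of the split `A → {A_l, A_r}` is the Jensen gap times `ν(A)`:
`G = ν(A) · ( E_{ν_A}[φ(X)] − φ(E_{ν_A}[X]) )`, where `ν_A = ν(· ∩ A)/ν(A)` and
`X = E_{ν_A}[f | σ({A_l, A_r})]`. -/
theorem stmt_1
    {X Y : Type*} [MeasurableSpace X] [MeasurableSpace Y]
    (PXY : Measure (X × Y)) [IsProbabilityMeasure PXY]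
    (μY : Measure Y) [SigmaFinite μY]
    (ν : Measure (X × Y)) (hν : ν = (PXY.map Prod.fst).prod μY)
    (hac : PXY ≪ ν)
    (f : X × Y → ℝ) (hf_meas : Measurable f) (hf_nonneg : ∀ z, 0 ≤ f z)
    (hf_int : Integrable f ν)
    (hf_dens : ∀ s : Set (X × Y), MeasurableSet s → (PXY s).toReal = ∫ z in s, f z ∂ν)
    (A Al Ar : Set (X × Y)) (hAm : MeasurableSet A)
    (hAl : MeasurableSet Al) (hAr : MeasurableSet Ar)
    (hlr : Disjoint Al Ar) (hsplit : A = Al ∪ Ar)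
    (hνA : 0 < ν A) (hνA' : ν A < ⊤) (hνl : 0 < ν Al) (hνr : 0 < ν Ar) :
    (ν Al).toReal * phi ((PXY Al).toReal / (ν Al).toReal)
      + (ν Ar).toReal * phi ((PXY Ar).toReal / (ν Ar).toReal)
      - (ν A).toReal * phi ((PXY A).toReal / (ν A).toReal)
    = (ν A).toReal *
        ((∫ z, phi ((((ν A)⁻¹ • ν.restrict A)[f|MeasurableSpace.generateFrom {Al, Ar}]) z)
            ∂((ν A)⁻¹ • ν.restrict A))
         - phi (∫ z, (((ν A)⁻¹ • ν.restrict A)[f|MeasurableSpace.generateFrom {Al, Ar}]) z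
            ∂((ν A)⁻¹ • ν.restrict A))) := by
  classical
  have hmle : MeasurableSpace.generateFrom {Al, Ar} ≤ (inferInstance : MeasurableSpace (X × Y)) := by
    apply MeasurableSpace.generateFrom_le
    rintro t (rfl | rfl) <;> assumption
  set μ : Measure (X × Y) := (ν A)⁻¹ • ν.restrict A with hμ
  set g := μ[f|MeasurableSpace.generateFrom {Al, Ar}] with hg
  have hgm : Measurable[MeasurableSpace.generateFrom {Al, Ar}] g :=
    stronglyMeasurable_condExp.measurable
  have hAlA : Al ⊆ A := hsplit ▸ Set.subset_union_left
  have hArA : Ar ⊆ A := hsplit ▸ Set.subset_union_right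
  have hlt : ν Al ≠ ⊤ := ((measure_mono hAlA).trans_lt hνA').ne
  have hrt : ν Ar ≠ ⊤ := ((measure_mono hArA).trans_lt hνA').ne
  have hfin : IsFiniteMeasure μ := by
    refine ⟨?_⟩
    rw [hμ]
    simp only [Measure.smul_apply, Measure.restrict_apply MeasurableSet.univ, Set.univ_inter,
      smul_eq_mul]
    exact ENNReal.mul_lt_top (ENNReal.inv_lt_top.2 hνA) hνA'
  have hfμ : Integrable f μ := hf_int.restrict.smul_measure (ENNReal.inv_ne_top.2 hνA.ne')
  have ha : 0 < (ν A).toReal := ENNReal.toReal_pos hνA.ne' hνA'.ne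
  have hal : 0 < (ν Al).toReal := ENNReal.toReal_pos hνl.ne' hlt
  have har : 0 < (ν Ar).toReal := ENNReal.toReal_pos hνr.ne' hrt
  have hint : ∀ h : X × Y → ℝ, ∫ z, h z ∂μ = (ν A).toReal⁻¹ * ∫ z in A, h z ∂ν := by
    intro h
    rw [hμ, integral_smul_measure, ENNReal.toReal_inv, smul_eq_mul]
  have hints : ∀ (h : X × Y → ℝ) (S : Set (X × Y)), MeasurableSet S → S ⊆ A →
      ∫ z in S, h z ∂μ = (ν A).toReal⁻¹ * ∫ z in S, h z ∂ν := by
    intro h S hS hSA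
    rw [hμ, Measure.restrict_smul, integral_smul_measure, ENNReal.toReal_inv, smul_eq_mul,
      Measure.restrict_restrict hS, Set.inter_eq_left.2 hSA]
  have key : ∀ S : Set (X × Y), S ∈ ({Al, Ar} : Set (Set (X × Y))) → S ⊆ A →
      (∀ t ∈ ({Al, Ar} : Set (Set (X × Y))), S ⊆ t ∨ Disjoint S t) →
      0 < ν S → ν S ≠ ⊤ → ∀ z ∈ S, g z = (PXY S).toReal / (ν S).toReal := by
    intro S hS hSA hC h0 htop z hz
    have hSm : MeasurableSet[MeasurableSpace.generateFrom {Al, Ar}] S :=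
      MeasurableSpace.measurableSet_generateFrom hS
    have hSm' : MeasurableSet S := hmle _ hSm
    have e1 : ∫ z in S, g z ∂μ = ∫ z in S, f z ∂μ := setIntegral_condExp hmle hfμ hSm
    rw [hints _ _ hSm' hSA, hints _ _ hSm' hSA, ← hf_dens S hSm'] at e1
    have e2 : ∫ w in S, g w ∂ν = ∫ w in S, g z ∂ν :=
      setIntegral_congr_fun hSm' fun w hw => const_aux _ S hC g hgm z w hz hw
    rw [e2, setIntegral_const, smul_eq_mul, Measure.real] at e1
    have e3 := mul_left_cancel₀ (inv_ne_zero ha.ne') e1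
    rw [eq_div_iff (ENNReal.toReal_pos h0.ne' htop).ne', mul_comm]
    exact e3
  have kl : ∀ z ∈ Al, g z = (PXY Al).toReal / (ν Al).toReal := by
    refine key Al (by simp) hAlA ?_ hνl hlt
    rintro t (rfl | rfl)
    · exact Or.inl subset_rfl
    · exact Or.inr hlr
  have kr : ∀ z ∈ Ar, g z = (PXY Ar).toReal / (ν Ar).toReal := by
    refine key Ar (by simp) hArA ?_ hνr hrt
    rintro t (rfl | rfl)
    · exact Or.inr hlr.symm
    · exact Or.inl subset_rfl
  have i1 : ∫ z, g z ∂μ = (PXY A).toReal / (ν A).toReal := by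
    rw [hg, integral_condExp hmle, hint, ← hf_dens A hAm]
    field_simp
  have cl : Set.EqOn (fun z => phi (g z)) (fun _ => phi ((PXY Al).toReal / (ν Al).toReal)) Al :=
    fun z hz => by simp only [kl z hz]
  have cr : Set.EqOn (fun z => phi (g z)) (fun _ => phi ((PXY Ar).toReal / (ν Ar).toReal)) Ar :=
    fun z hz => by simp only [kr z hz]
  have il : IntegrableOn (fun z => phi (g z)) Al ν :=
    (integrableOn_const hlt).congr_fun cl.symm hAl
  have ir : IntegrableOn (fun z => phi (g z)) Ar ν :=
    (integrableOn_const hrt).congr_fun cr.symm hAr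
  have i2 : ∫ z in A, phi (g z) ∂ν
      = (ν Al).toReal * phi ((PXY Al).toReal / (ν Al).toReal)
      + (ν Ar).toReal * phi ((PXY Ar).toReal / (ν Ar).toReal) := by
    rw [hsplit, setIntegral_union hlr hAr il ir, setIntegral_congr_fun hAl cl,
      setIntegral_congr_fun hAr cr, setIntegral_const, setIntegral_const]
    rfl
  rw [i1, hint, i2]
  field_simp
end

section
/- Let Σ = {1, …, K} with K ≥ 2, and for each c ∈ Σ let a_c ≥ 0 and b_c > 0, with r_c := a_c/b_c. For ∅ ≠ S ⊊ Σ write a_S := Σ_{c∈S} a_c, b_S := Σ_{c∈S} b_c, r_S := a_S/b_S, and define the split objective G(S) := b_S·φ(r_S) + b_{S^c}·φ(r_{S^c}), where φ(u) := u log u with 0 log 0 := 0 and S^c := Σ ∖ S. Then there exists a maximizer S* of G over all nonempty proper subsets of Σ that is a prefix under sorting by r_c: i.e., there exist a permutation σ of Σ with r_{σ(1)} ≤ r_{σ(2)} ≤ … ≤ r_{σ(K)} and an index t ∈ {1, …, K−1} such that S* = {σ(1), …, σ(t)} and G(S*) = max_{∅≠S⊊Σ} G(S). -/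
open Finset

/-- The subset-split objective `G(S) = b_S φ(r_S) + b_{S^c} φ(r_{S^c})`, where
`a_S = Σ_{c∈S} a_c`, `b_S = Σ_{c∈S} b_c` and `r_S = a_S / b_S`. -/
noncomputable def splitObj {K : ℕ} (a b : Fin K → ℝ) (S : Finset (Fin K)) : ℝ :=
  (∑ c ∈ S, b c) * phi ((∑ c ∈ S, a c) / (∑ c ∈ S, b c))
    + (∑ c ∈ Sᶜ, b c) * phi ((∑ c ∈ Sᶜ, a c) / (∑ c ∈ Sᶜ, b c))

lemma tangent_le (x y p : ℝ) (hx : 0 ≤ x) (hy : 0 < y) (hp : 0 < p) :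
    x * (Real.log p + 1) - p * y ≤ y * phi (x / y) := by
  unfold phi
  rcases hx.eq_or_lt with rfl | hx
  · simp; positivity
  · have h1 : y * (x / y * Real.log (x / y)) = x * Real.log (x / y) := by field_simp
    have h2 := Real.log_le_sub_one_of_pos (show 0 < p * y / x by positivity)
    rw [Real.log_div (by positivity) hx.ne', Real.log_mul hp.ne' hy.ne'] at h2
    have h4 := mul_le_mul_of_nonneg_left h2 hx.le
    have h5 : x * (p * y / x - 1) = p * y - x := by field_simp
    rw [h1, Real.log_div hx.ne' hy.ne']
    nlinarith

lemma exists_tangent (x y ε : ℝ) (hx : 0 ≤ x) (hy : 0 < y) (hε : 0 < ε) :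
    ∃ p, 0 < p ∧ y * phi (x / y) ≤ x * (Real.log p + 1) - p * y + ε := by
  unfold phi
  rcases hx.eq_or_lt with rfl | hx
  · refine ⟨ε / y, by positivity, ?_⟩
    have : ε / y * y = ε := by field_simp
    simp [this]
  · refine ⟨x / y, by positivity, ?_⟩
    have h1 : y * (x / y * Real.log (x / y)) = x * Real.log (x / y) := by field_simp
    have h2 : x / y * y = x := by field_simp
    rw [h1, h2]; linarith

/-- Tangent functional at `p`. -/
noncomputable def tang {K : ℕ} (a b : Fin K → ℝ) (p : ℝ) (c : Fin K) : ℝ :=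
  a c * (Real.log p + 1) - p * b c

lemma sum_tang {K : ℕ} (a b : Fin K → ℝ) (p : ℝ) (S : Finset (Fin K)) :
    ∑ c ∈ S, tang a b p c = (∑ c ∈ S, a c) * (Real.log p + 1) - p * ∑ c ∈ S, b c := by
  simp [tang, Finset.sum_sub_distrib, Finset.sum_mul, Finset.mul_sum]

lemma sum_tang_le {K : ℕ} (a b : Fin K → ℝ) (ha : ∀ c, 0 ≤ a c) (hb : ∀ c, 0 < b c) (p : ℝ)
    (hp : 0 < p) (S : Finset (Fin K)) (hS : S.Nonempty) :
    ∑ c ∈ S, tang a b p c ≤ (∑ c ∈ S, b c) * phi ((∑ c ∈ S, a c) / (∑ c ∈ S, b c)) := by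
  rw [sum_tang]
  exact tangent_le _ _ _ (Finset.sum_nonneg fun c _ => ha c) (Finset.sum_pos (fun c _ => hb c) hS) hp

lemma exists_sum_tang {K : ℕ} (a b : Fin K → ℝ) (ha : ∀ c, 0 ≤ a c) (hb : ∀ c, 0 < b c) (ε : ℝ)
    (hε : 0 < ε) (S : Finset (Fin K)) (hS : S.Nonempty) :
    ∃ p, 0 < p ∧ (∑ c ∈ S, b c) * phi ((∑ c ∈ S, a c) / (∑ c ∈ S, b c))
      ≤ ∑ c ∈ S, tang a b p c + ε := by
  simp only [sum_tang]
  exact exists_tangent _ _ _ (Finset.sum_nonneg fun c _ => ha c)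
    (Finset.sum_pos (fun c _ => hb c) hS) hε

lemma compl_ne {K : ℕ} (S : Finset (Fin K)) (hS : S ≠ Finset.univ) : Sᶜ.Nonempty := by
  rw [Finset.nonempty_iff_ne_empty]
  simpa using hS

/-- The unsplit value is at most any split value. -/
lemma unsplit_le {K : ℕ} (a b : Fin K → ℝ) (ha : ∀ c, 0 ≤ a c) (hb : ∀ c, 0 < b c)
    (S : Finset (Fin K)) (hS : S.Nonempty) (hS' : S ≠ Finset.univ) :
    (∑ c, b c) * phi ((∑ c, a c) / (∑ c, b c)) ≤ splitObj a b S := by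
  refine le_of_forall_pos_le_add fun ε hε => ?_
  obtain ⟨p, hp, h⟩ := exists_sum_tang a b ha hb ε hε Finset.univ (hS.mono (Finset.subset_univ _))
  have h1 := sum_tang_le a b ha hb p hp S hS
  have h2 := sum_tang_le a b ha hb p hp Sᶜ (compl_ne S hS')
  have h3 := Finset.sum_add_sum_compl S (tang a b p)
  unfold splitObj
  linarith

lemma prefix_bound (K : ℕ) (hK : 2 ≤ K) (a b : Fin K → ℝ)
    (ha : ∀ c, 0 ≤ a c) (hb : ∀ c, 0 < b c) (σ : Equiv.Perm (Fin K))
    (hσ : Monotone (fun i : Fin K => a (σ i) / b (σ i))) (m : ℝ)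
    (hm : ∀ t : ℕ, 1 ≤ t → t ≤ K - 1 →
      splitObj a b ((Finset.univ.filter fun i : Fin K => (i : ℕ) < t).image σ) ≤ m)
    (p q : ℝ) (hp : 0 < p) (hpq : p ≤ q) (S : Finset (Fin K)) :
    ∑ c ∈ S, tang a b p c + ∑ c ∈ Sᶜ, tang a b q c ≤ m := by
  have hq : 0 < q := hp.trans_le hpq
  have hlog : Real.log p ≤ Real.log q := Real.log_le_log hp hpq
  set f : Fin K → ℝ := fun c => tang a b p c - tang a b q c with hf
  have hfe : ∀ c, f c = b c * ((q - p) - a c / b c * (Real.log q - Real.log p)) := by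
    intro c
    have := (hb c).ne'
    simp only [hf, tang]
    field_simp
    ring
  have hanti : ∀ i j : Fin K, i ≤ j → 0 ≤ f (σ j) → 0 ≤ f (σ i) := by
    intro i j hij h
    rw [hfe] at h ⊢
    have h1 := nonneg_of_mul_nonneg_right h (hb _)
    have h2 := mul_le_mul_of_nonneg_right (hσ hij) (sub_nonneg.2 hlog)
    refine mul_nonneg (hb _).le ?_
    simp only at h2
    linarith
  obtain ⟨t, htK, ht⟩ : ∃ t : ℕ, t ≤ K ∧ ∀ i : Fin K, (i : ℕ) < t ↔ 0 ≤ f (σ i) := by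
    classical
    have hex : ∃ n : ℕ, ∀ i : Fin K, 0 ≤ f (σ i) → (i : ℕ) < n := ⟨K, fun i _ => i.2⟩
    refine ⟨Nat.find hex, Nat.find_min' hex (fun i _ => i.2), fun i => ⟨fun h => ?_, fun h => Nat.find_spec hex i h⟩⟩
    have := Nat.find_min hex h
    push Not at this
    obtain ⟨j, hj, hij⟩ := this
    exact hanti i j hij hj
  set P := (Finset.univ.filter fun i : Fin K => (i : ℕ) < t).image σ with hP
  have hmem : ∀ c, c ∈ P ↔ 0 ≤ f c := by
    intro c
    have h := ht (σ.symm c)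
    rw [Equiv.apply_symm_apply] at h
    rw [← h, hP]
    simp only [Finset.mem_image, Finset.mem_filter, Finset.mem_univ, true_and]
    constructor
    · rintro ⟨i, hi, rfl⟩; simpa using hi
    · intro h; exact ⟨σ.symm c, h, by simp⟩
  have hsum : ∑ c ∈ S, f c ≤ ∑ c ∈ P, f c := by
    rw [← Finset.sum_filter_add_sum_filter_not S (· ∈ P)]
    have h1 : ∑ c ∈ S with c ∉ P, f c ≤ 0 := Finset.sum_nonpos fun c hc => by
      have := (Finset.mem_filter.1 hc).2
      rw [hmem] at this; linarith
    have h2 : ∑ c ∈ S with c ∈ P, f c ≤ ∑ c ∈ P, f c :=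
      Finset.sum_le_sum_of_subset_of_nonneg (fun c hc => (Finset.mem_filter.1 hc).2)
        fun c hc _ => (hmem c).1 hc
    linarith
  have hdec : ∀ T : Finset (Fin K), ∑ c ∈ T, tang a b p c + ∑ c ∈ Tᶜ, tang a b q c
      = ∑ c, tang a b q c + ∑ c ∈ T, f c := by
    intro T
    rw [← Finset.sum_add_sum_compl T (tang a b q), hf, Finset.sum_sub_distrib]
    ring
  have key : ∑ c ∈ S, tang a b p c + ∑ c ∈ Sᶜ, tang a b q c
      ≤ ∑ c ∈ P, tang a b p c + ∑ c ∈ Pᶜ, tang a b q c := by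
    rw [hdec, hdec]; linarith
  have hne : ∀ s : ℕ, 1 ≤ s →
      ((Finset.univ.filter fun i : Fin K => (i : ℕ) < s).image σ).Nonempty := by
    intro s hs
    exact ⟨σ ⟨0, by omega⟩, Finset.mem_image_of_mem _ (by simp; omega)⟩
  have hnu : ∀ s : ℕ, s ≤ K - 1 →
      ((Finset.univ.filter fun i : Fin K => (i : ℕ) < s).image σ) ≠ Finset.univ := by
    intro s hs h
    have := Finset.mem_univ (σ ⟨K - 1, by omega⟩)
    rw [← h] at this
    simp at this
    omega
  have hun : (∑ c, b c) * phi ((∑ c, a c) / (∑ c, b c)) ≤ m :=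
    (unsplit_le a b ha hb _ (hne 1 le_rfl) (hnu 1 (by omega))).trans (hm 1 le_rfl (by omega))
  have huniv : (Finset.univ : Finset (Fin K)).Nonempty := ⟨⟨0, by omega⟩, Finset.mem_univ _⟩
  by_cases h0 : P = ∅
  · rw [h0] at key
    simp only [Finset.sum_empty, Finset.compl_empty, zero_add] at key
    exact key.trans ((sum_tang_le a b ha hb q hq _ huniv).trans hun)
  by_cases h1 : P = Finset.univ
  · rw [h1] at key
    simp only [Finset.sum_empty, Finset.compl_univ, add_zero] at key
    exact key.trans ((sum_tang_le a b ha hb p hp _ huniv).trans hun)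
  have ht1 : 1 ≤ t := by
    by_contra h
    apply h0
    have : t = 0 := by omega
    rw [hP, this]; simp
  have ht2 : t ≤ K - 1 := by
    by_contra h
    apply h1
    have : t = K := by omega
    rw [hP, this]; simp
  have h2 := sum_tang_le a b ha hb p hp P (Finset.nonempty_iff_ne_empty.2 h0)
  have h3 := sum_tang_le a b ha hb q hq Pᶜ (compl_ne P h1)
  have h4 := hm t ht1 ht2
  rw [← hP] at h4
  unfold splitObj at h4
  linarith



/-- There is a maximizer of `G` over nonempty proper subsets of `Σ = Fin K` that is a
prefix after sorting the categories by `r_c = a_c / b_c`. -/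
theorem stmt_5 (K : ℕ) (hK : 2 ≤ K) (a b : Fin K → ℝ)
    (ha : ∀ c, 0 ≤ a c) (hb : ∀ c, 0 < b c) :
    ∃ (σ : Equiv.Perm (Fin K)) (t : ℕ),
      Monotone (fun i : Fin K => a (σ i) / b (σ i)) ∧
      1 ≤ t ∧ t ≤ K - 1 ∧
      ∀ S : Finset (Fin K), S.Nonempty → S ≠ Finset.univ →
        splitObj a b S ≤
          splitObj a b ((Finset.univ.filter fun i : Fin K => (i : ℕ) < t).image σ) := by
  obtain ⟨t, ht, hmax⟩ := Finset.exists_max_image (Finset.Icc 1 (K - 1))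
    (fun t : ℕ => splitObj a b ((Finset.univ.filter fun i : Fin K => (i : ℕ) < t).image
      (Tuple.sort fun c => a c / b c))) ⟨1, by simp; omega⟩
  have hσ := Tuple.monotone_sort fun c => a c / b c
  rw [Finset.mem_Icc] at ht
  refine ⟨Tuple.sort fun c => a c / b c, t, hσ, ht.1, ht.2, fun S hS hS' => ?_⟩
  refine le_of_forall_pos_le_add fun ε hε => ?_
  obtain ⟨p, hp, h1⟩ := exists_sum_tang a b ha hb (ε / 2) (half_pos hε) S hS
  obtain ⟨q, hq, h2⟩ := exists_sum_tang a b ha hb (ε / 2) (half_pos hε) Sᶜ (compl_ne S hS')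
  have hb' := prefix_bound K hK a b ha hb _ hσ _
    (fun s h1 h2 => hmax s (Finset.mem_Icc.2 ⟨h1, h2⟩))
  have h3 : ∑ c ∈ S, tang a b p c + ∑ c ∈ Sᶜ, tang a b q c ≤ splitObj a b ((Finset.univ.filter fun i : Fin K => (i : ℕ) < t).image
      (Tuple.sort fun c => a c / b c)) := by
    rcases le_total p q with h | h
    · exact hb' p q hp h S
    · have := hb' q p hq h Sᶜ
      rw [compl_compl, add_comm] at this
      exact this
  have h4 : splitObj a b S ≤ ∑ c ∈ S, tang a b p c + ∑ c ∈ Sᶜ, tang a b q c + ε := by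
    unfold splitObj; linarith
  linarith
end

section
/- Let μ_Y be a σ-finite measure on a measurable space 𝒴, let P_X be a probability measure on a measurable space 𝒳, and set ν := P_X ⊗ μ_Y. Assume P_XY ≪ ν and let f := dP_XY/d(P_X ⊗ μ_Y), so that ∫_𝒴 f(x, y) dμ_Y(y) = 1 for P_X-almost every x. Let h_N : 𝒳 × 𝒴 → [0, ∞) be measurable, define s_N(x) := ∫_𝒴 h_N(x, y) dμ_Y(y), and the normalized estimator h̄_N(x, y) := h_N(x, y)/s_N(x) if s_N(x) > 0 and h̄_N(x, y) := 0 if s_N(x) = 0. Then for every N, ‖h̄_N − f‖_{L¹(ν)} ≤ 6·‖h_N − f‖_{L¹(ν)}; consequently, if ‖h_N − f‖_{L¹(ν)} → 0 then ‖h̄_N − f‖_{L¹(ν)} → 0. -/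
open MeasureTheory Filter

lemma aux_point {Y : Type*} [MeasurableSpace Y] (μ : Measure Y) (f h : Y → ℝ)
    (hf : Measurable f) (hh : Measurable h) (hf0 : ∀ y, 0 ≤ f y) (hh0 : ∀ y, 0 ≤ h y)
    (hf1 : ∫ y, f y ∂μ = 1) (g : Y → ℝ)
    (hg : ∀ y, g y = if 0 < ∫⁻ y', ENNReal.ofReal (h y') ∂μ then
          h y / (∫⁻ y', ENNReal.ofReal (h y') ∂μ).toReal else 0) :
    ∫⁻ y, ENNReal.ofReal |g y - f y| ∂μ ≤ 6 * ∫⁻ y, ENNReal.ofReal |h y - f y| ∂μ := by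
  have hfi : Integrable f μ := by
    by_contra hn
    rw [integral_undef hn] at hf1
    norm_num at hf1
  have hF : ∫⁻ y, ENNReal.ofReal (f y) ∂μ = 1 := by
    rw [← ofReal_integral_eq_lintegral_ofReal hfi (Eventually.of_forall hf0), hf1]
    simp
  have hDm : Measurable fun y => ENNReal.ofReal |h y - f y| := by fun_prop
  set D := ∫⁻ y, ENNReal.ofReal |h y - f y| ∂μ with hD
  have hgen : ∫⁻ y, ENNReal.ofReal |g y - f y| ∂μ ≤ 2 * D →
      ∫⁻ y, ENNReal.ofReal |g y - f y| ∂μ ≤ 6 * D := by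
    intro hle
    refine hle.trans ?_
    gcongr
    norm_num
  set S := ∫⁻ y, ENNReal.ofReal (h y) ∂μ with hS
  have hFSD : 1 ≤ S + D := by
    rw [← hF, hS, hD, ← lintegral_add_right _ hDm]
    refine lintegral_mono fun y => ?_
    rw [← ENNReal.ofReal_add (hh0 y) (abs_nonneg _)]
    apply ENNReal.ofReal_le_ofReal
    linarith [neg_abs_le (h y - f y)]
  have hSFD : S ≤ 1 + D := by
    rw [← hF, hS, hD, ← lintegral_add_right _ hDm]
    refine lintegral_mono fun y => ?_
    rw [← ENNReal.ofReal_add (hf0 y) (abs_nonneg _)]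
    apply ENNReal.ofReal_le_ofReal
    linarith [le_abs_self (h y - f y)]
  rcases eq_or_ne S ⊤ with hT | hT
  · have : D = ⊤ := by
      by_contra hne
      rw [hT] at hSFD
      exact (ENNReal.add_ne_top.2 ⟨ENNReal.one_ne_top, hne⟩) (top_le_iff.1 hSFD)
    rw [this, ENNReal.mul_top (by norm_num)]
    exact le_top
  rcases eq_or_ne S 0 with h0 | h0
  · apply hgen
    have : ∀ y, ENNReal.ofReal |g y - f y| = ENNReal.ofReal (f y) := by
      intro y
      rw [hg y, h0]
      simp [abs_of_nonneg (hf0 y)]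
    simp_rw [this]
    rw [hF]
    rw [h0, zero_add] at hFSD
    rw [two_mul]
    exact hFSD.trans le_self_add
  · apply hgen
    have hs : 0 < S.toReal := ENNReal.toReal_pos h0 hT
    have hhi : Integrable h μ := by
      refine ⟨hh.aestronglyMeasurable, ?_⟩
      rw [hasFiniteIntegral_iff_ofReal (Eventually.of_forall hh0)]
      exact lt_top_iff_ne_top.2 hT
    have hint : ∫ y, h y ∂μ = S.toReal :=
      integral_eq_lintegral_of_nonneg_ae (Eventually.of_forall hh0) hh.aestronglyMeasurable
    have h1 : ENNReal.ofReal |S.toReal - 1| ≤ D := by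
      have := enorm_integral_le_lintegral_enorm (μ := μ) (fun y => h y - f y)
      rw [integral_sub hhi hfi, hint, hf1] at this
      simpa only [Real.enorm_eq_ofReal_abs] using this
    have h2 : ∫⁻ y, ENNReal.ofReal |g y - f y| ∂μ ≤
        ∫⁻ y, (ENNReal.ofReal |1 / S.toReal - 1| * ENNReal.ofReal (h y)
          + ENNReal.ofReal |h y - f y|) ∂μ := by
      refine lintegral_mono fun y => ?_
      rw [← ENNReal.ofReal_mul (abs_nonneg _), ← ENNReal.ofReal_add
        (mul_nonneg (abs_nonneg _) (hh0 y)) (abs_nonneg _)]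
      apply ENNReal.ofReal_le_ofReal
      rw [hg y, if_pos (pos_iff_ne_zero.2 h0)]
      have e : |1 / S.toReal - 1| * h y = |h y / S.toReal - h y| := by
        rw [← abs_of_nonneg (hh0 y), ← abs_mul, abs_of_nonneg (hh0 y)]
        congr 1
        ring
      rw [e]
      exact abs_sub_le _ _ _
    refine h2.trans ?_
    rw [lintegral_add_right _ hDm, lintegral_const_mul _ (by fun_prop), two_mul]
    gcongr
    refine le_trans (le_of_eq ?_) h1
    change _ * S = _
    conv_lhs => rw [← ENNReal.ofReal_toReal hT]
    rw [← ENNReal.ofReal_mul (abs_nonneg _), ENNReal.toReal_ofReal hs.le]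
    congr 1
    nth_rewrite 2 [← abs_of_pos hs]
    rw [← abs_mul, abs_sub_comm S.toReal]
    congr 1
    field_simp

/-- Normalization preserves `L¹(ν)`-consistency: with `ν = P_X ⊗ μ_Y`, `f = dP_XY/dν`
(a conditional density), `s_N(x) = ∫ h_N(x, ·) dμ_Y` and
`h̄_N(x, ·) = h_N(x, ·)/s_N(x)` when `s_N(x) > 0` (and `0` otherwise), one has
`‖h̄_N − f‖_{L¹(ν)} ≤ 6 ‖h_N − f‖_{L¹(ν)}` for every `N`; hence
`‖h_N − f‖_{L¹(ν)} → 0` implies `‖h̄_N − f‖_{L¹(ν)} → 0`. -/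
theorem stmt_10
    {X Y : Type*} [MeasurableSpace X] [MeasurableSpace Y]
    (μY : Measure Y) [SigmaFinite μY]
    (PXY : Measure (X × Y)) [IsProbabilityMeasure PXY]
    (PX : Measure X) [IsProbabilityMeasure PX] (hPX : PX = PXY.map Prod.fst)
    (ν : Measure (X × Y)) (hν : ν = PX.prod μY)
    (f : X × Y → ℝ) (hf_meas : Measurable f) (hf_nonneg : ∀ z, 0 ≤ f z)
    (hf_dens : PXY = ν.withDensity fun z => ENNReal.ofReal (f z))
    (hf_norm : ∀ᵐ x ∂PX, ∫ y, f (x, y) ∂μY = 1)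
    (h : ℕ → X × Y → ℝ)
    (hh_meas : ∀ N, Measurable (h N)) (hh_nonneg : ∀ N z, 0 ≤ h N z)
    (hbar : ℕ → X × Y → ℝ)
    (hhbar : ∀ N x y,
      hbar N (x, y) =
        if 0 < ∫⁻ y', ENNReal.ofReal (h N (x, y')) ∂μY then
          h N (x, y) / (∫⁻ y', ENNReal.ofReal (h N (x, y')) ∂μY).toReal
        else 0) :
    (∀ N, ∫⁻ z, ENNReal.ofReal |hbar N z - f z| ∂ν
        ≤ 6 * ∫⁻ z, ENNReal.ofReal |h N z - f z| ∂ν) ∧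
    (Tendsto (fun N => ∫⁻ z, ENNReal.ofReal |h N z - f z| ∂ν) atTop (nhds 0) →
      Tendsto (fun N => ∫⁻ z, ENNReal.ofReal |hbar N z - f z| ∂ν) atTop (nhds 0)) := by
  have key : ∀ N, ∫⁻ z, ENNReal.ofReal |hbar N z - f z| ∂ν
        ≤ 6 * ∫⁻ z, ENNReal.ofReal |h N z - f z| ∂ν := by
    intro N
    have hm := hh_meas N
    have hDm : Measurable fun z => ENNReal.ofReal |h N z - f z| := by fun_prop
    rw [hν]
    refine (lintegral_prod_le _).trans ?_
    rw [lintegral_prod _ hDm.aemeasurable, ← lintegral_const_mul _ hDm.lintegral_prod_right']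
    refine lintegral_mono_ae ?_
    filter_upwards [hf_norm] with x hx
    exact aux_point μY (fun y => f (x, y)) (fun y => h N (x, y))
      (by fun_prop) (by fun_prop) (fun y => hf_nonneg _) (fun y => hh_nonneg N _) hx
      (fun y => hbar N (x, y)) (fun y => hhbar N x y)
  refine ⟨key, fun ht => ?_⟩
  have h6 := ENNReal.Tendsto.const_mul (a := 6) ht (Or.inr (by norm_num))
  rw [mul_zero] at h6
  exact tendsto_of_tendsto_of_tendsto_of_le_of_le tendsto_const_nhds h6
    (fun _ => zero_le) key
end

section
/- Let (Z̄, d) be a pseudometric space with finite diameter, and for a subset A ⊆ Z̄ let diam(A) denote its metric diameter. Let a sequence of partitions π^{(0)} = {Z̄}, π^{(1)}, …, π^{(k)} of Z̄ be constructed so that π^{(s+1)} is obtained from π^{(s)} by splitting a single cell A ∈ π^{(s)} into two disjoint cells A_l, A_r with A = A_l ∪ A_r, where: (i) the split cell A has the largest diameter among all cells of π^{(s)} (ties broken arbitrarily), and (ii) max(diam(A_l), diam(A_r)) ≤ ρ·diam(A) for a fixed ρ ∈ [1/2, 1). Then, with n_s := ⌊log₂(k + 1)⌋, every cell A ∈ π^{(k)}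 satisfies diam(A) ≤ diam(Z̄)·ρ^{n_s}. In particular, for γ := diam(Z̄)·ρ^{⌊log₂(k+1)⌋}, the set {z ∈ Z̄ : diam(π^{(k)}[z]) > γ} is empty. -/
/-- Deterministic shrinkage under greedy largest-diameter splitting: starting from the
single-cell partition `{Z̄}` of a set of finite diameter, performing `k` binary splits,
each applied to a cell of maximal diameter and each contracting diameters by a factor
`ρ ∈ [1/2, 1)`, every final cell has diameter at most `diam(Z̄)·ρ^⌊log₂(k+1)⌋`; in
particular no point lies in a cell of diameter exceeding `γ = diam(Z̄)·ρ^⌊log₂(k+1)⌋`. -/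
theorem stmt_12
    {Z : Type*} [PseudoMetricSpace Z]
    (Zbar : Set Z) (hZb : Bornology.IsBounded Zbar)
    (ρ : ℝ) (hρ1 : 1 / 2 ≤ ρ) (hρ2 : ρ < 1)
    (k : ℕ) (π : ℕ → Set (Set Z))
    (hπ0 : π 0 = {Zbar})
    (hstep : ∀ s < k, ∃ A ∈ π s, ∃ Al Ar : Set Z,
      (∀ B ∈ π s, Metric.diam B ≤ Metric.diam A) ∧
      Disjoint Al Ar ∧ A = Al ∪ Ar ∧
      Metric.diam Al ≤ ρ * Metric.diam A ∧
      Metric.diam Ar ≤ ρ * Metric.diam A ∧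
      π (s + 1) = (π s \ {A}) ∪ {Al, Ar}) :
    (∀ A ∈ π k, Metric.diam A ≤ Metric.diam Zbar * ρ ^ (Nat.log 2 (k + 1))) ∧
    {z : Z | z ∈ Zbar ∧ ∃ A ∈ π k, z ∈ A ∧
        Metric.diam Zbar * ρ ^ (Nat.log 2 (k + 1)) < Metric.diam A} = ∅ := by
  have hρ0 : 0 ≤ ρ := by linarith
  have hcard : ∀ s, s ≤ k → (π s).Finite ∧ (π s).ncard ≤ s + 1 := by
    intro s
    induction s with
    | zero => intro _; rw [hπ0]; simp
    | succ s ih =>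
      intro hs
      obtain ⟨hf, hc⟩ := ih (by omega)
      obtain ⟨A, hA, Al, Ar, -, -, -, -, -, he⟩ := hstep s (by omega)
      rw [he]
      refine ⟨hf.diff.union (by simp), ?_⟩
      have h1 := Set.ncard_union_le (π s \ {A}) {Al, Ar}
      have h2 := Set.ncard_sdiff_singleton_add_one hA hf
      have h3 := Set.ncard_insert_le Al {Ar}
      rw [Set.ncard_singleton] at h3
      omega
  have key : ∀ s M, (∀ B ∈ π s, Metric.diam B ≤ M) → 0 ≤ M → ∀ j, s + j ≤ k →
      (∀ B ∈ π (s + j), Metric.diam B ≤ M) ∧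
      {B ∈ π (s + j) | ρ * M < Metric.diam B}.ncard ≤ (π s).ncard - j := by
    intro s M hM hM0 j
    induction j with
    | zero =>
      intro hs
      exact ⟨hM, Set.ncard_le_ncard (fun B hB => hB.1) (hcard s (by omega)).1⟩
    | succ j ih =>
      intro hs
      obtain ⟨h1, h2⟩ := ih (by omega)
      obtain ⟨A, hA, Al, Ar, hmax, -, -, hl, hr, he⟩ := hstep (s + j) (by omega)
      have hf := (hcard (s + j) (by omega)).1
      have hAM : ρ * Metric.diam A ≤ ρ * M := mul_le_mul_of_nonneg_left (h1 A hA) hρ0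
      have hMM : ρ * M ≤ M := by nlinarith
      rw [← add_assoc, he]
      refine ⟨?_, ?_⟩
      · rintro B (hB | rfl | rfl)
        · exact h1 B hB.1
        · linarith
        · linarith
      · have hfS : {B ∈ π (s + j) | ρ * M < Metric.diam B}.Finite :=
          hf.subset (fun B hB => hB.1)
        have hsub : {B ∈ (π (s + j) \ {A}) ∪ {Al, Ar} | ρ * M < Metric.diam B} ⊆
            {B ∈ π (s + j) | ρ * M < Metric.diam B} \ {A} := by
          rintro B ⟨hB | rfl | rfl, hB2⟩
          · exact ⟨⟨hB.1, hB2⟩, hB.2⟩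
          · linarith
          · linarith
        have h3 := Set.ncard_le_ncard hsub hfS.diff
        by_cases hAS : ρ * M < Metric.diam A
        · have h4 := Set.ncard_sdiff_singleton_add_one
            (show A ∈ {B ∈ π (s + j) | ρ * M < Metric.diam B} from ⟨hA, hAS⟩) hfS
          omega
        · have h5 : {B ∈ π (s + j) | ρ * M < Metric.diam B} = ∅ := by
            ext B
            simp only [Set.mem_setOf_eq, Set.mem_empty_iff_false, iff_false, not_and, not_lt]
            intro hB
            exact (hmax B hB).trans (not_lt.1 hAS)
          rw [h5] at h3
          simp only [Set.empty_sdiff, Set.ncard_empty] at h3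
          omega
  have hD : (0 : ℝ) ≤ Metric.diam Zbar := Metric.diam_nonneg
  have main : ∀ n, 2 ^ n - 1 ≤ k →
      ∀ B ∈ π (2 ^ n - 1), Metric.diam B ≤ Metric.diam Zbar * ρ ^ n := by
    intro n
    induction n with
    | zero =>
      intro _ B hB
      have : B = Zbar := by simpa [hπ0] using hB
      simp [this]
    | succ n ih =>
      intro hn B hB
      have hp : 0 < 2 ^ n := by positivity
      have e : 2 ^ (n + 1) - 1 = (2 ^ n - 1) + 2 ^ n := by rw [pow_succ]; omega
      rw [e] at hn hB
      have h2 := (key _ _ (ih (by omega)) (by positivity) (2 ^ n) hn).2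
      have h3 := (hcard (2 ^ n - 1) (by omega)).2
      have hfS : {B ∈ π (2 ^ n - 1 + 2 ^ n) |
          ρ * (Metric.diam Zbar * ρ ^ n) < Metric.diam B}.Finite :=
        (hcard _ hn).1.subset (fun B hB => hB.1)
      have h4 := (Set.ncard_eq_zero hfS).1 (by omega)
      by_contra hlt
      have : B ∈ {B ∈ π (2 ^ n - 1 + 2 ^ n) |
          ρ * (Metric.diam Zbar * ρ ^ n) < Metric.diam B} := by
        refine ⟨hB, ?_⟩
        rw [not_le] at hlt
        calc _ = Metric.diam Zbar * ρ ^ (n + 1) := by ring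
          _ < _ := hlt
      rw [h4] at this
      exact this
  have fin : ∀ A ∈ π k, Metric.diam A ≤ Metric.diam Zbar * ρ ^ (Nat.log 2 (k + 1)) := by
    have hle : 2 ^ (Nat.log 2 (k + 1)) ≤ k + 1 := Nat.pow_log_le_self 2 (by omega)
    have h := (key _ _ (main (Nat.log 2 (k + 1)) (by omega)) (by positivity)
      (k - (2 ^ (Nat.log 2 (k + 1)) - 1)) (by omega)).1
    rwa [Nat.add_sub_cancel' (by omega)] at h
  refine ⟨fin, ?_⟩
  ext z
  simp only [Set.mem_setOf_eq, Set.mem_empty_iff_false, iff_false]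
  rintro ⟨-, A, hA, -, hlt⟩
  exact absurd (fin A hA) (not_le.2 hlt)
end

section
/- Under the greedy largest-diameter splitting process with per-split contraction factor ρ ∈ [1/2, 1) (each split replaces a current cell A of maximal diameter by two disjoint cells whose diameters are at most ρ·diam(A)), the maximum cell diameter M_s := max_{A ∈ π^{(s)}} diam(A) after s splits satisfies, for every integer m ≥ 0 with 2^m − 1 ≤ total number of splits performed, the bound M_{2^m − 1} ≤ diam(Z̄)·ρ^m. -/
/-- Binary-level bound for the greedy largest-diameter splitting process with contraction
factor `ρ ∈ [1/2, 1)`: after `2^m − 1` splits (whenever `2^m − 1 ≤ k`, the total number of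
splits performed), the maximum cell diameter satisfies `M_{2^m−1} ≤ diam(Z̄)·ρ^m`, i.e.
every cell of `π^{(2^m−1)}` has diameter at most `diam(Z̄)·ρ^m`. -/
theorem stmt_13
    {Z : Type*} [PseudoMetricSpace Z]
    (Zbar : Set Z) (hZb : Bornology.IsBounded Zbar)
    (ρ : ℝ) (hρ1 : 1 / 2 ≤ ρ) (hρ2 : ρ < 1)
    (k : ℕ) (π : ℕ → Set (Set Z))
    (hπ0 : π 0 = {Zbar})
    (hstep : ∀ s < k, ∃ A ∈ π s, ∃ Al Ar : Set Z,
      (∀ B ∈ π s, Metric.diam B ≤ Metric.diam A) ∧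
      Disjoint Al Ar ∧ A = Al ∪ Ar ∧
      Metric.diam Al ≤ ρ * Metric.diam A ∧
      Metric.diam Ar ≤ ρ * Metric.diam A ∧
      π (s + 1) = (π s \ {A}) ∪ {Al, Ar}) :
    ∀ m : ℕ, 2 ^ m - 1 ≤ k →
      ∀ A ∈ π (2 ^ m - 1), Metric.diam A ≤ Metric.diam Zbar * ρ ^ m := by
  have hρ0 : 0 ≤ ρ := by linarith
  have hcard : ∀ s, s ≤ k → (π s).Finite ∧ (π s).ncard ≤ s + 1 := by
    intro s
    induction s with
    | zero => intro _; rw [hπ0]; simp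
    | succ s ih =>
      intro hs
      obtain ⟨hf, hc⟩ := ih (by omega)
      obtain ⟨A, hA, Al, Ar, -, -, -, -, -, he⟩ := hstep s (by omega)
      rw [he]
      refine ⟨(hf.subset Set.sdiff_subset).union (Set.toFinite _), ?_⟩
      have h1 := Set.ncard_union_le (π s \ {A}) {Al, Ar}
      have h2 := Set.ncard_sdiff_singleton_add_one hA hf
      have h3 : ({Al, Ar} : Set (Set Z)).ncard ≤ 2 := by
        have := Set.ncard_insert_le Al {Ar}
        rwa [Set.ncard_singleton] at this
      omega
  intro m
  induction m with
  | zero =>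
    intro _ A hA
    have hA' : A ∈ π 0 := by simpa using hA
    rw [hπ0] at hA'
    rw [Set.mem_singleton_iff.mp hA']
    simp
  | succ m ih =>
    intro hk
    have hpos : 0 < 2 ^ m := by positivity
    have hpow : 2 ^ (m + 1) = 2 ^ m + 2 ^ m := by ring
    have ih' := ih (by omega)
    set D := Metric.diam Zbar with hD
    have key : ∀ j, j ≤ 2 ^ m →
        (∀ B ∈ π (2 ^ m - 1 + j), Metric.diam B ≤ D * ρ ^ m) ∧
        {B ∈ π (2 ^ m - 1 + j) | D * ρ ^ (m + 1) < Metric.diam B}.ncard ≤ 2 ^ m - j := by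
      intro j
      induction j with
      | zero =>
        intro _
        obtain ⟨hf, hc⟩ := hcard (2 ^ m - 1) (by omega)
        refine ⟨ih', ?_⟩
        have h1 : {B ∈ π (2 ^ m - 1 + 0) | D * ρ ^ (m + 1) < Metric.diam B}.ncard
            ≤ (π (2 ^ m - 1)).ncard := Set.ncard_le_ncard (Set.sep_subset _ _) hf
        omega
      | succ j ihj =>
        intro hj
        obtain ⟨hd, hb⟩ := ihj (by omega)
        obtain ⟨hf, -⟩ := hcard (2 ^ m - 1 + j) (by omega)
        obtain ⟨A, hA, Al, Ar, hmax, -, -, hl, hr, he⟩ := hstep (2 ^ m - 1 + j) (by omega)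
        have hA1 := hd A hA
        have hA0 : 0 ≤ Metric.diam A := Metric.diam_nonneg
        have hAρ : ρ * Metric.diam A ≤ D * ρ ^ (m + 1) := by
          calc ρ * Metric.diam A ≤ ρ * (D * ρ ^ m) := mul_le_mul_of_nonneg_left hA1 hρ0
            _ = D * ρ ^ (m + 1) := by ring
        have hAρ' : ρ * Metric.diam A ≤ D * ρ ^ m := by nlinarith
        rw [← Nat.add_assoc, he]
        constructor
        · rintro B (hB | hB | hB)
          · exact hd B hB.1
          · rw [hB]; exact hl.trans hAρ'
          · rw [Set.mem_singleton_iff.mp hB]; exact hr.trans hAρ'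
        · have hsub : {B ∈ (π (2 ^ m - 1 + j) \ {A}) ∪ {Al, Ar} |
              D * ρ ^ (m + 1) < Metric.diam B} ⊆
              {B ∈ π (2 ^ m - 1 + j) | D * ρ ^ (m + 1) < Metric.diam B} \ {A} := by
            rintro B ⟨hB | hB | hB, hlt⟩
            · exact ⟨⟨hB.1, hlt⟩, hB.2⟩
            · rw [hB] at hlt; linarith
            · rw [Set.mem_singleton_iff.mp hB] at hlt; linarith
          have hbf : {B ∈ π (2 ^ m - 1 + j) | D * ρ ^ (m + 1) < Metric.diam B}.Finite :=
            hf.subset (Set.sep_subset _ _)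
          have hle := Set.ncard_le_ncard hsub (hbf.subset Set.sdiff_subset)
          by_cases hbad : D * ρ ^ (m + 1) < Metric.diam A
          · have h2 := Set.ncard_sdiff_singleton_add_one
              (show A ∈ {B ∈ π (2 ^ m - 1 + j) | D * ρ ^ (m + 1) < Metric.diam B} from
                ⟨hA, hbad⟩) hbf
            omega
          · have hemp : {B ∈ π (2 ^ m - 1 + j) | D * ρ ^ (m + 1) < Metric.diam B} = ∅ := by
              ext B
              simp only [Set.mem_ofPred_eq, Set.mem_empty_iff_false, iff_false, not_and, not_lt]
              intro hB
              exact (hmax B hB).trans (not_lt.mp hbad)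
            rw [hemp] at hle
            simp only [Set.empty_sdiff, Set.ncard_empty] at hle
            omega
    obtain ⟨-, hb⟩ := key (2 ^ m) le_rfl
    have hidx : 2 ^ m - 1 + 2 ^ m = 2 ^ (m + 1) - 1 := by omega
    rw [hidx] at hb
    obtain ⟨hf, -⟩ := hcard (2 ^ (m + 1) - 1) hk
    intro A hA
    by_contra hcon
    have h0 := (Set.ncard_pos (hf.subset (Set.sep_subset _ _))).mpr
      (⟨A, hA, not_le.mp hcon⟩ :
        {B ∈ π (2 ^ (m + 1) - 1) | D * ρ ^ (m + 1) < Metric.diam B}.Nonempty)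
    omega
end
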